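/- There is no function θ : ℝ → ℝ of class C⁴ such that θ(x) > 0 for all x, θ(x) → 0 as x → ±∞, the derivatives θ′, θ″, θ‴ are bounded on ℝ, and θ satisfies (1/2)·θ(x) = θ(x)²·(−θ⁗(x) + θ(x)) for all x ∈ ℝ. -/

import Mathlib

theorem ContDiff.hasDerivAt_iteratedDeriv {f : ℝ → ℝ} {n : WithTop ℕ∞} {k : ℕ}
    (hf : ContDiff ℝ n f) (hk : (k : WithTop ℕ∞) < n) (x : ℝ) :
    HasDerivAt (iteratedDeriv k f) (iteratedDeriv (k + 1) f x) x := by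
  rw [iteratedDeriv_succ]
  exact (hf.differentiable_iteratedDeriv k hk x).hasDerivAt

/-- The first integral of the profile equation `(1/2)θ = θ²(−θ⁗ + θ)`. -/
noncomputable def profileFirstIntegral (θ : ℝ → ℝ) (x : ℝ) : ℝ :=
  1 / 2 * Real.log (θ x) + deriv θ x * iteratedDeriv 3 θ x
    - 1 / 2 * iteratedDeriv 2 θ x ^ 2 - 1 / 2 * θ x ^ 2

theorem profileFirstIntegral_eq {θ : ℝ → ℝ} (hθ : ContDiff ℝ 4 θ) (hpos : ∀ x, 0 < θ x)
    (hode : ∀ x, (1 / 2 : ℝ) * θ x = θ x ^ 2 * (-(iteratedDeriv 4 θ x) + θ x)) (x y : ℝ) :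
    profileFirstIntegral θ x = profileFirstIntegral θ y := by
  have hderiv (x : ℝ) : HasDerivAt (profileFirstIntegral θ) 0 x := by
    have h₀ : HasDerivAt θ (deriv θ x) x := (hθ.differentiable (by norm_num) x).hasDerivAt
    have h₁ : HasDerivAt (deriv θ) (iteratedDeriv 2 θ x) x := by
      simpa only [iteratedDeriv_one] using
        hθ.hasDerivAt_iteratedDeriv (k := 1) (by norm_num) x
    have h₂ := hθ.hasDerivAt_iteratedDeriv (k := 2) (by norm_num) x
    have h₃ := hθ.hasDerivAt_iteratedDeriv (k := 3) (by norm_num) x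
    have hx := (hpos x).ne'
    have h := ((((h₀.log hx).const_mul (1 / 2)).add (h₁.mul h₃)).sub
      ((h₂.pow 2).const_mul (1 / 2))).sub ((h₀.pow 2).const_mul (1 / 2))
    refine h.congr_deriv ?_
    have hfourth : iteratedDeriv 4 θ x = θ x - 1 / (2 * θ x) := by
      have := hode x
      field_simp
      apply mul_left_cancel₀ hx
      linear_combination 2 * this
    norm_num [hfourth]
    field_simp
    ring
  exact is_const_of_deriv_eq_zero (fun x => (hderiv x).differentiableAt)
    (fun x => (hderiv x).deriv) x y

/-- Nonexistence of positive separable blow-up profiles on the whole line for the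
fourth-order reaction-diffusion equation `u_t = u²(−u_xxxx + u)`: there is no
`θ ∈ C⁴(ℝ)` with `θ > 0`, `θ(x) → 0` as `x → ±∞`, bounded `θ′, θ″, θ‴`, satisfying
`(1/2)θ = θ²(−θ⁗ + θ)` on `ℝ`. -/
theorem no_fourth_order_blowup_profile_line :
    ¬ ∃ θ : ℝ → ℝ,
      ContDiff ℝ 4 θ ∧
      (∀ x, 0 < θ x) ∧
      Filter.Tendsto θ Filter.atTop (nhds 0) ∧
      Filter.Tendsto θ Filter.atBot (nhds 0) ∧
      (∃ M : ℝ, ∀ x, |deriv θ x| ≤ M ∧ |iteratedDeriv 2 θ x| ≤ M ∧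
        |iteratedDeriv 3 θ x| ≤ M) ∧
      (∀ x, (1/2 : ℝ) * θ x = (θ x)^2 * (-(iteratedDeriv 4 θ x) + θ x)) := by
  rintro ⟨θ, hθ, hpos, htop, -, ⟨M, hM⟩, hode⟩
  have hlog : Filter.Tendsto (fun x => Real.log (θ x)) Filter.atTop Filter.atBot :=
    Real.tendsto_log_nhdsGT_zero.comp
      (tendsto_nhdsWithin_iff.2 ⟨htop, Filter.Eventually.of_forall hpos⟩)
  obtain ⟨x, hx⟩ :=
    (hlog.eventually_lt_atBot (2 * profileFirstIntegral θ 0 - 2 * M ^ 2)).exists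
  have hconst := profileFirstIntegral_eq hθ hpos hode x 0
  rw [profileFirstIntegral] at hconst
  obtain ⟨h₁, -, h₃⟩ := hM x
  have hprod : deriv θ x * iteratedDeriv 3 θ x ≤ M ^ 2 :=
    calc deriv θ x * iteratedDeriv 3 θ x
        ≤ |deriv θ x| * |iteratedDeriv 3 θ x| := (le_abs_self _).trans (abs_mul _ _).le
      _ ≤ M * M := mul_le_mul h₁ h₃ (abs_nonneg _) ((abs_nonneg _).trans h₁)
      _ = M ^ 2 := (sq M).symm
  linarith [sq_nonneg (iteratedDeriv 2 θ x), sq_nonneg (θ x)]
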